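/- arXiv:2208.13610 — 2 statements merged into one kernel-verified Lean document; each statement's English description precedes it below -/
import Mathlib

section
/- Let n ≥ 1 with N = 2^n, let γ = {γ_u} be strictly positive weights, and let z = (z_1,…,z_s) ∈ {1,…,N−1}^s with gcd(z_j, N) = 1 for all j satisfy H_{s,n,γ}(z) ≤ N · Σ_{∅≠v⊆{1,…,s}} (log 4)^{|v|} γ_v. Then T_{1,γ}(N,z) ≤ Σ_{∅≠u⊆{1,…,s}} (γ_u/N)(log 4 + 2(1 + log N))^{|u|} + Σ_{∅≠u⊆{1,…,s}} (γ_u/N) · 2^{|u|+1} · (1 + 2 log N)^{|u|} · (1 + log N). -/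
open Finset MeasureTheory

noncomputable section

/-- `lsin a = log (1 / sin² (π a))`. -/
def lsin (a : ℝ) : ℝ := Real.log (1 / Real.sin (Real.pi * a) ^ 2)

/-- The support of `m ∈ ℤ^s`, viewed as a subset of `{1,…,s} ⊂ ℕ`
(component `j : Fin s` corresponds to the index `j+1 ∈ {1,…,s}`). -/
def msupp {s : ℕ} (m : Fin s → ℤ) : Finset ℕ :=
  (Finset.univ.filter fun j => m j ≠ 0).image fun j : Fin s => (j : ℕ) + 1

/-- `r_{α,γ}(m) = γ_{supp(m)}⁻¹ ∏_{j ∈ supp(m)} |m_j|^α`. -/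
def rweight {s : ℕ} (α : ℝ) (γ : Finset ℕ → ℝ) (m : Fin s → ℤ) : ℝ :=
  (γ (msupp m))⁻¹ * ∏ j ∈ Finset.univ.filter (fun j => m j ≠ 0), |(m j : ℝ)| ^ α

/-- The truncated quantity
`T_{α,γ}(N,z) = ∑_{m ∈ M_{N,s}\{0}, m·z ≡ 0 (mod N)} 1 / r_{α,γ}(m)`,
where `M_{N,s} = {-(N-1),…,N-1}^s` and the components of `z` are `z 1, …, z s`. -/
def Tsum (α : ℝ) (γ : Finset ℕ → ℝ) (N s : ℕ) (z : ℕ → ℤ) : ℝ :=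
  ∑ m ∈ (Fintype.piFinset fun _ : Fin s => Finset.Icc (-(N : ℤ) + 1) ((N : ℤ) - 1)).filter
      (fun m => m ≠ 0 ∧ (∑ j : Fin s, m j * z ((j : ℕ) + 1)) % (N : ℤ) = 0),
    1 / rweight α γ m

/-- `H_{s,n,γ}(z) = ∑_{k=1}^{2^n-1} ∑_{∅≠u⊆{1,…,s}} γ_u ∏_{j∈u} log(1/sin²(π k z_j/2^n))`. -/
def Hsum (γ : Finset ℕ → ℝ) (s n : ℕ) (z : ℕ → ℤ) : ℝ :=
  ∑ k ∈ Finset.Icc (1:ℕ) (2 ^ n - 1),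
    ∑ u ∈ (Finset.Icc 1 s).powerset.filter (· ≠ ∅),
      γ u * ∏ j ∈ u, lsin ((k : ℝ) * (z j : ℝ) / 2 ^ n)

/-- The digit-wise quality function `h_{r,n,v,γ}(x)` (with previously chosen
components `z 1, …, z (r-1)`). -/
def hqual (γ : Finset ℕ → ℝ) (n v r : ℕ) (z : ℕ → ℤ) (x : ℤ) : ℝ :=
  ∑ t ∈ Finset.Icc v n, (1 / 2 ^ (t - v) : ℝ) *
    ∑ k ∈ (Finset.Icc (1:ℕ) (2 ^ t - 1)).filter (fun k => Odd k),
      ((∑ u ∈ (Finset.Icc 1 (r - 1)).powerset.filter (· ≠ ∅),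
          γ u * ∏ j ∈ u, lsin ((k : ℝ) * (z j : ℝ) / 2 ^ t)) +
        ∑ u ∈ (Finset.Icc 1 (r - 1)).powerset,
          γ (u ∪ {r}) * lsin ((k : ℝ) * (x : ℝ) / 2 ^ v) *
            ∏ j ∈ u, lsin ((k : ℝ) * (z j : ℝ) / 2 ^ t))

/-- `z = (z 1, …, z s)` is (a possible) output of the component-by-component
digit-by-digit construction (Algorithm 1) with inputs `n`, `s` and weights `γ`:
`z 1 = 1`, and for `r = 2,…,s` one has `z_{r,1} = 1` and for `v = 2,…,n`,
`z_{r,v} = z_{r,v-1} + z* 2^{v-1}` where `z* ∈ {0,1}` minimizes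
`z ↦ h_{r,n,v,γ}(z_{r,v-1} + z 2^{v-1})`; finally `z r = z_{r,n}`. -/
def IsCBCDBD (γ : Finset ℕ → ℝ) (n s : ℕ) (z : ℕ → ℤ) : Prop :=
  z 1 = 1 ∧
  ∃ zz : ℕ → ℕ → ℤ,
    ∀ r ∈ Finset.Icc 2 s, zz r 1 = 1 ∧ z r = zz r n ∧
      ∀ v ∈ Finset.Icc 2 n, ∃ zs ∈ ({0, 1} : Set ℤ),
        zz r v = zz r (v - 1) + zs * 2 ^ (v - 1) ∧
        ∀ w ∈ ({0, 1} : Set ℤ),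
          hqual γ n v r z (zz r (v - 1) + zs * 2 ^ (v - 1)) ≤
            hqual γ n v r z (zz r (v - 1) + w * 2 ^ (v - 1))

/-- The weights `γ ∪ v`, i.e. `(γ ∪ v)_u = γ_{u ∪ v}`. -/
def unionWeights (γ : Finset ℕ → ℝ) (v : Finset ℕ) : Finset ℕ → ℝ :=
  fun u => γ (u ∪ v)

/-- `γ̃_j = max_{v ⊆ {1,…,j-1}} γ_{v ∪ {j}} / γ_v`. -/
def tildeW (γ : Finset ℕ → ℝ) (j : ℕ) : ℝ :=
  (Finset.Icc 1 (j - 1)).powerset.sup' ⟨∅, Finset.empty_mem_powerset _⟩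
    fun v => γ (insert j v) / γ v

/-- The unit cube `[0,1]^s`. -/
def cube (s : ℕ) : Set (Fin s → ℝ) := Set.univ.pi fun _ => Set.Icc 0 1

/-- The Fourier coefficient `f̂(m) = ∫_{[0,1]^s} f(x) e^{-2πi m·x} dx`. -/
def fcoeff (s : ℕ) (f : (Fin s → ℝ) → ℂ) (m : Fin s → ℤ) : ℂ :=
  ∫ x in cube s,
    f x * Complex.exp (-(2 * (Real.pi : ℂ) * Complex.I) * ∑ j, (m j : ℂ) * (x j : ℂ))

/-- The rank-1 lattice rule `Q_{N,s}(f,z) = (1/N) ∑_{k=0}^{N-1} f({k z / N})`. -/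
def qmc (N s : ℕ) (z : ℕ → ℤ) (f : (Fin s → ℝ) → ℂ) : ℂ :=
  (N : ℂ)⁻¹ * ∑ k ∈ Finset.range N,
    f fun j => Int.fract ((k : ℝ) * (z ((j : ℕ) + 1) : ℝ) / (N : ℝ))

/-- The worst-case error `e_{N,s,α,γ}(z)` of the rank-1 lattice rule with generating
vector `z` in the unit ball of the space `E^α_{s,γ}` (whose elements are identified
with their continuous representatives). -/
def wce (N s : ℕ) (α : ℝ) (γ : Finset ℕ → ℝ) (z : ℕ → ℤ) : ℝ :=
  ⨆ f ∈ {f : (Fin s → ℝ) → ℂ |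
      Continuous f ∧ ∀ m : Fin s → ℤ, ‖fcoeff s f m‖ * rweight α γ m ≤ 1},
    ‖(∫ x in cube s, f x) - qmc N s z f‖

/-- For POD weights given by `(Γ_ℓ)` and `(γ_j)`:
`p_{m,ℓ,t}(k) = ∑_{u ⊆ {1,…,m}, |u| = ℓ} Γ_ℓ ∏_{j∈u} γ_j log(1/sin²(π k z_j/2^t))`. -/
def psum (Γ γw : ℕ → ℝ) (z : ℕ → ℤ) (m ℓ t : ℕ) (k : ℕ) : ℝ :=
  ∑ u ∈ (Finset.Icc 1 m).powerset.filter (fun u => u.card = ℓ),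
    Γ ℓ * ∏ j ∈ u, γw j * lsin ((k : ℝ) * (z j : ℝ) / 2 ^ t)

lemma aux_abel1 (w : ℂ) (hw : ‖w‖ ≤ 1) (N : ℕ) (hN : 1 ≤ N) (p : ℕ) :
    ‖(1-w) * ∑ i ∈ range p, w^(i+N)/((i+N : ℕ):ℂ) + w^(p+N)/((p+N:ℕ):ℂ)‖ ≤ 2/(N:ℝ) - 1/((p+N:ℕ):ℝ) := by
  have hN0 : (0:ℝ) < N := by exact_mod_cast hN
  induction p with
  | zero =>
    simp only [range_zero, sum_empty, mul_zero, zero_add, norm_div, norm_pow, Complex.norm_natCast]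
    have : ‖w‖^N ≤ 1 := pow_le_one₀ (norm_nonneg _) hw
    calc ‖w‖^N / (N:ℝ) ≤ 1 / N := by gcongr
      _ = _ := by ring
  | succ p ih =>
    set M : ℕ := p + N with hM
    have hM1 : p + 1 + N = M + 1 := by omega
    have hM0 : (0:ℝ) < (M:ℝ) := by exact_mod_cast (by omega : 0 < M)
    have hMc : (M:ℂ) ≠ 0 := by exact_mod_cast hM0.ne'
    have hMc1 : ((M+1:ℕ):ℂ) ≠ 0 := by exact_mod_cast (Nat.succ_ne_zero M)
    rw [sum_range_succ, hM1]
    have e : (1-w) * (∑ i ∈ range p, w^(i+N)/((i+N : ℕ):ℂ) + w^(p+N)/((p+N:ℕ):ℂ)) + w^(M+1)/((M+1:ℕ):ℂ)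
      = ((1-w) * ∑ i ∈ range p, w^(i+N)/((i+N : ℕ):ℂ) + w^M/(M:ℂ)) + w^(M+1) * ((1/((M+1:ℕ):ℝ) - 1/(M:ℝ) : ℝ) : ℂ) := by
      rw [← hM]; push_cast at hMc1 ⊢; field_simp; ring
    rw [e]
    refine (norm_add_le _ _).trans ?_
    have h2 : ‖w^(M+1) * ((1/((M+1:ℕ):ℝ) - 1/(M:ℝ) : ℝ) : ℂ)‖ ≤ 1/(M:ℝ) - 1/((M+1:ℕ):ℝ) := by
      rw [norm_mul, norm_pow, Complex.norm_real, Real.norm_eq_abs, abs_sub_comm]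
      have h3 : 1/((M+1:ℕ):ℝ) ≤ 1/(M:ℝ) := by
        apply one_div_le_one_div_of_le hM0; push_cast; linarith
      rw [abs_of_nonneg (by linarith)]
      have : ‖w‖^(M+1) ≤ 1 := pow_le_one₀ (norm_nonneg _) hw
      nlinarith
    linarith

lemma aux_abel2 (w : ℂ) (hw : ‖w‖ ≤ 1) (N : ℕ) (hN : 1 ≤ N) (p : ℕ) :
    ‖(1-w) * ∑ i ∈ range p, w^(i+N)/((i+N : ℕ):ℂ)‖ ≤ 2/(N:ℝ) := by
  have h := aux_abel1 w hw N hN p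
  have h2 : ‖w^(p+N)/((p+N:ℕ):ℂ)‖ ≤ 1/((p+N:ℕ):ℝ) := by
    rw [norm_div, norm_pow, Complex.norm_natCast]
    have : ‖w‖^(p+N) ≤ 1 := pow_le_one₀ (norm_nonneg _) hw
    gcongr
  have h3 := norm_sub_le ((1-w) * ∑ i ∈ range p, w^(i+N)/((i+N : ℕ):ℂ) + w^(p+N)/((p+N:ℕ):ℂ)) (w^(p+N)/((p+N:ℕ):ℂ))
  rw [add_sub_cancel_right] at h3
  linarith

lemma aux_abel3 (w : ℂ) (hw : ‖w‖ < 1) (N : ℕ) (hN : 1 ≤ N) :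
    ‖(1-w) * (-Complex.log (1-w) - ∑ i ∈ range N, w^i/(i:ℂ))‖ ≤ 2/(N:ℝ) := by
  have h := Complex.hasSum_taylorSeries_neg_log hw
  have h2 := ((hasSum_nat_add_iff' N).mpr h).mul_left (1-w)
  have h3 := h2.tendsto_sum_nat.norm
  refine le_of_tendsto h3 (Filter.Eventually.of_forall fun p => ?_)
  rw [← mul_sum]
  exact aux_abel2 w hw.le N hN p

lemma aux_abel4 (w : ℂ) (hw : ‖w‖ = 1) (hw1 : w ≠ 1) (N : ℕ) (hN : 1 ≤ N) :
    ‖(1-w) * (-Complex.log (1-w) - ∑ i ∈ range N, w^i/(i:ℂ))‖ ≤ 2/(N:ℝ) := by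
  have hsl : 1 - w ∈ Complex.slitPlane := by
    left
    simp only [Complex.sub_re, Complex.one_re, sub_pos]
    refine lt_of_le_of_ne (by rw [← hw]; exact Complex.re_le_norm w) ?_
    intro h
    apply hw1
    have := Complex.sq_norm w
    rw [hw, Complex.normSq_apply, h] at this
    apply Complex.ext
    · simpa using h
    · simp; nlinarith
  have hc : ContinuousAt (fun r : ℝ => ‖(1-(r:ℂ)*w) * (-Complex.log (1-(r:ℂ)*w) - ∑ i ∈ range N, ((r:ℂ)*w)^i/(i:ℂ))‖) 1 := by
    apply ContinuousAt.norm
    apply ContinuousAt.mul (by fun_prop)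
    apply ContinuousAt.sub _ (by fun_prop)
    apply ContinuousAt.neg
    apply ContinuousAt.clog (by fun_prop)
    simpa using hsl
  have ht := (hc.tendsto).mono_left (nhdsWithin_le_nhds (s := Set.Iio 1))
  simp only [Complex.ofReal_one, one_mul] at ht
  refine le_of_tendsto ht ?_
  have : Set.Ioo (0:ℝ) 1 ∈ nhdsWithin (1:ℝ) (Set.Iio 1) := Ioo_mem_nhdsLT (by norm_num)
  filter_upwards [this] with r hr
  apply aux_abel3 _ _ N hN
  rw [norm_mul, hw, Complex.norm_real, Real.norm_eq_abs, abs_of_pos hr.1]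
  linarith [hr.2]

lemma aux_lsin (x : ℝ) (hx : Real.sin (Real.pi * x) ≠ 0) (N : ℕ) (hN : 1 ≤ N) :
    |(Real.log 4 + 2 * ∑ m ∈ range N, Real.cos (2 * Real.pi * m * x) / m) - lsin x|
      ≤ 2 / (N * |Real.sin (Real.pi * x)|) := by
  set w : ℂ := Complex.exp ((2 * Real.pi * x : ℝ) * Complex.I) with hwdef
  have hw : ‖w‖ = 1 := Complex.norm_exp_ofReal_mul_I _
  have hre : w.re = Real.cos (2 * Real.pi * x) := Complex.exp_ofReal_mul_I_re _
  have him : w.im = Real.sin (2 * Real.pi * x) := Complex.exp_ofReal_mul_I_im _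
  have hn : ‖1 - w‖ = 2 * |Real.sin (Real.pi * x)| := by
    have e2 : 2 * |Real.sin (Real.pi * x)| = |2 * Real.sin (Real.pi * x)| := by rw [abs_mul, abs_two]
    rw [e2, ← abs_of_nonneg (norm_nonneg (1-w)), ← sq_eq_sq_iff_abs_eq_abs, Complex.sq_norm, Complex.normSq_apply]
    simp only [Complex.sub_re, Complex.sub_im, Complex.one_re, Complex.one_im, hre, him]
    have h1 : 2 * Real.pi * x = 2 * (Real.pi * x) := by ring
    rw [h1, Real.cos_two_mul, Real.sin_two_mul]
    have := Real.sin_sq_add_cos_sq (Real.pi * x)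
    have h2 : Real.cos (Real.pi * x)^2 = 1 - Real.sin (Real.pi * x)^2 := by linarith
    ring_nf
    have h4 : Real.cos (Real.pi * x)^4 = (Real.cos (Real.pi * x)^2)^2 := by ring
    rw [h4, h2]; ring
  have hs : 0 < |Real.sin (Real.pi * x)| := abs_pos.mpr hx
  have hw1 : w ≠ 1 := by
    intro h; rw [h] at hn; simp at hn; exact hx hn
  have h := aux_abel4 w hw hw1 N hN
  rw [norm_mul, hn] at h
  have hr := Complex.abs_re_le_norm (-Complex.log (1-w) - ∑ i ∈ range N, w^i/(i:ℂ))
  have hre2 : (-Complex.log (1-w) - ∑ i ∈ range N, w^i/(i:ℂ)).re = - Real.log (2 * |Real.sin (Real.pi * x)|) - ∑ m ∈ range N, Real.cos (2 * Real.pi * m * x) / m := by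
    rw [Complex.sub_re, Complex.neg_re, Complex.log_re, hn, Complex.re_sum]
    congr 1
    apply sum_congr rfl
    intro i _
    rw [Complex.div_natCast_re, hwdef, ← Complex.exp_nat_mul]
    congr 1
    have : (i:ℂ) * ((2 * Real.pi * x : ℝ) * Complex.I) = ((2 * Real.pi * i * x : ℝ) : ℂ) * Complex.I := by
      push_cast; ring
    rw [this, Complex.exp_ofReal_mul_I_re]
  have hl : lsin x = Real.log 4 - 2 * Real.log (2 * |Real.sin (Real.pi * x)|) := by
    unfold lsin
    rw [← sq_abs, one_div, Real.log_inv, Real.log_pow, Real.log_mul (by norm_num) hs.ne',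
      show (4:ℝ) = 2^2 by norm_num, Real.log_pow]
    push_cast; ring
  rw [hre2] at hr
  have e : (Real.log 4 + 2 * ∑ m ∈ range N, Real.cos (2 * Real.pi * m * x) / m) - lsin x = -(2 * (- Real.log (2 * |Real.sin (Real.pi * x)|) - ∑ m ∈ range N, Real.cos (2 * Real.pi * m * x) / m)) := by
    rw [hl]; ring
  rw [e, abs_neg, abs_mul, abs_two]
  have hN0 : (0:ℝ) < N := by exact_mod_cast hN
  rw [le_div_iff₀ (by positivity)]
  rw [le_div_iff₀ hN0] at h
  set X := ‖-Complex.log (1-w) - ∑ i ∈ range N, w^i/(i:ℂ)‖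
  set A := |(- Real.log (2 * |Real.sin (Real.pi * x)|) - ∑ m ∈ range N, Real.cos (2 * Real.pi * m * x) / m)|
  have := mul_le_mul_of_nonneg_right hr (mul_pos hN0 hs).le
  nlinarith

lemma aux_prod (u : Finset ℕ) (a b : ℕ → ℝ) (B : ℝ) (hB : 1 ≤ B)
    (ha : ∀ j ∈ u, |a j| ≤ B) (hb : ∀ j ∈ u, |b j| ≤ B) :
    |∏ j ∈ u, b j - ∏ j ∈ u, a j| ≤ (∑ j ∈ u, |b j - a j|) * B ^ u.card := by
  induction u using Finset.induction_on with
  | empty => simp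
  | insert i u hi ih =>
    have ih := ih (fun j hj => ha j (mem_insert_of_mem hj)) (fun j hj => hb j (mem_insert_of_mem hj))
    rw [prod_insert hi, prod_insert hi, sum_insert hi, card_insert_of_notMem hi]
    have hbp : |∏ j ∈ u, b j| ≤ B ^ u.card := by
      rw [abs_prod, ← prod_const]
      exact prod_le_prod (fun _ _ => abs_nonneg _) (fun j hj => hb j (mem_insert_of_mem hj))
    have hai := ha i (mem_insert_self _ _)
    have e : b i * ∏ j ∈ u, b j - a i * ∏ j ∈ u, a j = (b i - a i) * ∏ j ∈ u, b j + a i * (∏ j ∈ u, b j - ∏ j ∈ u, a j) := by ring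
    rw [e]
    refine (abs_add_le _ _).trans ?_
    rw [abs_mul, abs_mul]
    have h0 : 0 ≤ B ^ u.card := by positivity
    have h1 : B ^ u.card ≤ B ^ (u.card+1) := pow_le_pow_right₀ hB (Nat.le_succ _)
    have h2 : |b i - a i| * |∏ j ∈ u, b j| ≤ |b i - a i| * B ^ (u.card+1) := by
      gcongr; exact hbp.trans h1
    have h3 : |a i| * |∏ j ∈ u, b j - ∏ j ∈ u, a j| ≤ B * ((∑ j ∈ u, |b j - a j|) * B ^ u.card) := by
      gcongr
    rw [add_mul]
    refine (add_le_add h2 h3).trans (le_of_eq ?_)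
    ring

lemma aux_sin (N : ℕ) (a q : ℤ) (r : ℕ) (hr : 1 ≤ r) (hrN : r < N) (ha : a = N * q + r) :
    2 / N ≤ |Real.sin (Real.pi * ((a:ℝ) / N))| ∧
    2 / (N * |Real.sin (Real.pi * ((a:ℝ) / N))|) ≤ 1 / (r:ℝ) + 1 / ((N - r : ℕ) : ℝ) := by
  have hN0 : (0:ℝ) < N := by exact_mod_cast (by omega : 0 < N)
  have hr0 : (1:ℝ) ≤ r := by exact_mod_cast hr
  have hrN' : (1:ℝ) ≤ ((N - r : ℕ) : ℝ) := by exact_mod_cast (by omega : 1 ≤ N - r)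
  have hcast : ((N - r : ℕ) : ℝ) = N - r := by push_cast [hrN.le]; ring
  have e1 : |Real.sin (Real.pi * ((a:ℝ) / N))| = |Real.sin (Real.pi * (r / N))| := by
    have : Real.pi * ((a:ℝ) / N) = Real.pi * (r / N) + q * Real.pi := by
      rw [ha]; push_cast; field_simp; ring
    rw [this, Real.sin_add_int_mul_pi, abs_mul, abs_zpow]; simp
  have hpi := Real.pi_pos
  have key : ∃ t : ℝ, 1 ≤ t ∧ 1 / t ≤ 1 / (r:ℝ) + 1 / ((N - r : ℕ) : ℝ) ∧ 2 * t / N ≤ Real.sin (Real.pi * (r / N)) := by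
    rcases le_total (2 * (r:ℝ)) N with h | h
    · refine ⟨r, hr0, ?_, ?_⟩
      · have : 0 ≤ 1 / ((N - r : ℕ) : ℝ) := by positivity
        linarith
      · have := Real.mul_le_sin (x := Real.pi * (r / N)) (by positivity) (by
          rw [mul_div_assoc', div_le_div_iff₀ hN0 two_pos]; nlinarith)
        calc 2 * (r:ℝ) / N = 2 / Real.pi * (Real.pi * (r / N)) := by field_simp
          _ ≤ _ := this
    · refine ⟨((N - r : ℕ) : ℝ), hrN', ?_, ?_⟩
      · have : 0 ≤ 1 / (r : ℝ) := by positivity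
        linarith
      · have e2 : Real.sin (Real.pi * (r / N)) = Real.sin (Real.pi * (((N - r : ℕ) : ℝ) / N)) := by
          rw [← Real.sin_pi_sub]; congr 1; rw [hcast]; field_simp
        rw [e2]
        have := Real.mul_le_sin (x := Real.pi * (((N - r : ℕ) : ℝ) / N)) (by positivity) (by
          rw [mul_div_assoc', div_le_div_iff₀ hN0 two_pos, hcast]; nlinarith)
        calc 2 * ((N - r : ℕ) : ℝ) / N = 2 / Real.pi * (Real.pi * (((N - r : ℕ) : ℝ) / N)) := by field_simp
          _ ≤ _ := this
  obtain ⟨t, ht1, ht2, ht3⟩ := key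
  rw [e1]
  have h4 : 2 * t / N ≤ |Real.sin (Real.pi * (r / N))| := ht3.trans (le_abs_self _)
  have ht0 : 0 < t := by linarith
  constructor
  · refine le_trans ?_ h4
    gcongr; linarith
  · refine le_trans ?_ ht2
    calc 2 / (N * |Real.sin (Real.pi * (r / N))|) ≤ 2 / (N * (2 * t / N)) := by gcongr
      _ = 1 / t := by field_simp

lemma aux_harm (N : ℕ) (hN : 1 ≤ N) : ∑ m ∈ range N, 1 / (m:ℝ) ≤ 1 + Real.log N := by
  obtain ⟨M, rfl⟩ : ∃ M, N = M + 1 := ⟨N - 1, by omega⟩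
  rw [sum_range_succ']
  have h := harmonic_le_one_add_log M
  have h2 : ∑ k ∈ range M, 1 / ((k + 1 : ℕ):ℝ) = ((harmonic M : ℚ) : ℝ) := by
    simp [harmonic]
  rw [h2]
  simp only [Nat.cast_zero, div_zero, add_zero]
  refine h.trans ?_
  rcases Nat.eq_zero_or_pos M with rfl | hM
  · simp
  · have : (0:ℝ) < M := by exact_mod_cast hM
    gcongr; linarith

lemma aux_perm (N : ℕ) (hN : 1 ≤ N) (z : ℤ) (hz : IsCoprime z (N:ℤ)) (f : ℕ → ℝ) (hf : ∀ r, 0 ≤ f r) :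
    ∑ k ∈ Icc 1 (N-1), f (((k:ℤ) * z % N).toNat) ≤ ∑ r ∈ Icc 1 (N-1), f r := by
  have hN0 : (0:ℤ) < N := by exact_mod_cast hN
  have hinj : Set.InjOn (fun k : ℕ => ((k:ℤ) * z % N).toNat) (Icc 1 (N-1) : Finset ℕ) := by
    intro k hk l hl h
    simp only [coe_Icc, Set.mem_Icc] at hk hl
    simp only at h
    have h1 := Int.emod_nonneg ((k:ℤ) * z) hN0.ne'
    have h2 := Int.emod_nonneg ((l:ℤ) * z) hN0.ne'
    have h3 : (k:ℤ) * z % N = (l:ℤ) * z % N := by omega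
    have h4 : (N:ℤ) ∣ ((k:ℤ) - l) * z := by
      rw [sub_mul]; exact (Int.ModEq.dvd (Int.ModEq.symm h3))
    have h5 := hz.symm.dvd_of_dvd_mul_right h4
    have h6 := Int.eq_zero_of_abs_lt_dvd h5 (by rw [abs_lt]; omega)
    omega
  rw [← sum_image (f := f) (g := fun k : ℕ => ((k:ℤ) * z % N).toNat) hinj]
  apply sum_le_sum_of_subset_of_nonneg
  · intro r hr
    obtain ⟨k, hk, rfl⟩ := mem_image.mp hr
    rw [mem_Icc] at hk ⊢
    have h1 := Int.emod_nonneg ((k:ℤ) * z) hN0.ne'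
    have h2 := Int.emod_lt_of_pos ((k:ℤ) * z) hN0
    have h3 : (k:ℤ) * z % N ≠ 0 := by
      intro h
      have h5 := hz.symm.dvd_of_dvd_mul_right (Int.dvd_of_emod_eq_zero h)
      have h6 := Int.eq_zero_of_abs_lt_dvd h5 (by rw [abs_lt]; omega)
      omega
    omega
  · intros; exact hf _

lemma aux_perm_sum (N : ℕ) (hN : 1 ≤ N) (z : ℤ) (hz : IsCoprime z (N:ℤ)) :
    ∑ k ∈ Icc 1 (N-1), 2 / (N * |Real.sin (Real.pi * ((k:ℝ) * z / N))|) ≤ 2 * (1 + Real.log N) := by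
  have hN0 : (0:ℤ) < N := by exact_mod_cast hN
  have h1 := aux_perm N hN z hz (fun r => 1 / (r:ℝ) + 1 / ((N - r : ℕ) : ℝ)) (fun r => by positivity)
  have h2 : ∑ r ∈ Icc 1 (N-1), 1 / (r:ℝ) ≤ 1 + Real.log N := by
    refine le_trans (sum_le_sum_of_subset_of_nonneg ?_ ?_) (aux_harm N hN)
    · intro r; simp; omega
    · intros; positivity
  have h3 : ∑ r ∈ Icc 1 (N-1), 1 / ((N - r : ℕ):ℝ) = ∑ r ∈ Icc 1 (N-1), 1 / (r:ℝ) := by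
    apply sum_nbij' (fun r => N - r) (fun r => N - r)
    · intro r; simp; omega
    · intro r; simp; omega
    · intro r; simp; omega
    · intro r; simp; omega
    · intros; rfl
  refine le_trans (sum_le_sum ?_) (h1.trans (by rw [sum_add_distrib, h3]; linarith))
  intro k hk
  rw [mem_Icc] at hk
  have g1 := Int.emod_nonneg ((k:ℤ) * z) hN0.ne'
  have g2 := Int.emod_lt_of_pos ((k:ℤ) * z) hN0
  have g3 : (k:ℤ) * z % N ≠ 0 := by
    intro h
    have h5 := hz.symm.dvd_of_dvd_mul_right (Int.dvd_of_emod_eq_zero h)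
    have h6 := Int.eq_zero_of_abs_lt_dvd h5 (by rw [abs_lt]; omega)
    omega
  have := (aux_sin N ((k:ℤ) * z) ((k:ℤ) * z / N) (((k:ℤ) * z % N).toNat) (by omega) (by omega) (by
    rw [Int.toNat_of_nonneg g1]; exact (Int.mul_ediv_add_emod _ _).symm)).2
  push_cast at this ⊢
  exact this

lemma aux_sin_lb (N : ℕ) (hN : 1 ≤ N) (z : ℤ) (hz : IsCoprime z (N:ℤ)) (k : ℕ) (hk : k ∈ Icc 1 (N-1)) :
    2 / N ≤ |Real.sin (Real.pi * ((k:ℝ) * z / N))| := by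
  have hN0 : (0:ℤ) < N := by exact_mod_cast hN
  rw [mem_Icc] at hk
  have g1 := Int.emod_nonneg ((k:ℤ) * z) hN0.ne'
  have g2 := Int.emod_lt_of_pos ((k:ℤ) * z) hN0
  have g3 : (k:ℤ) * z % N ≠ 0 := by
    intro h
    have h5 := hz.symm.dvd_of_dvd_mul_right (Int.dvd_of_emod_eq_zero h)
    have h6 := Int.eq_zero_of_abs_lt_dvd h5 (by rw [abs_lt]; omega)
    omega
  have := (aux_sin N ((k:ℤ) * z) ((k:ℤ) * z / N) (((k:ℤ) * z % N).toNat) (by omega) (by omega) (by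
    rw [Int.toNat_of_nonneg g1]; exact (Int.mul_ediv_add_emod _ _).symm)).1
  push_cast at this ⊢
  exact this

def auxG (N : ℕ) (x : ℝ) : ℝ := Real.log 4 + 2 * ∑ m ∈ range N, Real.cos (2 * Real.pi * m * x) / m

lemma aux_error (N : ℕ) (hN : 1 ≤ N) (z : ℕ → ℤ) (U : Finset ℕ) (hz : ∀ j ∈ U, IsCoprime (z j) (N:ℤ)) :
    ∑ k ∈ Icc 1 (N-1), ∏ j ∈ U, auxG N ((k:ℝ) * z j / N) ≤
      ∑ k ∈ Icc 1 (N-1), ∏ j ∈ U, lsin ((k:ℝ) * z j / N) +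
      2 ^ (U.card + 1) * (1 + 2 * Real.log N) ^ U.card * (1 + Real.log N) := by
  have hN0 : (1:ℝ) ≤ N := by exact_mod_cast hN
  have hL : 0 ≤ Real.log N := Real.log_nonneg hN0
  set B := 1 + 2 * Real.log N with hB
  have hB1 : 1 ≤ B := by linarith
  have step : ∀ k ∈ Icc 1 (N-1), ∏ j ∈ U, auxG N ((k:ℝ) * z j / N) ≤ ∏ j ∈ U, lsin ((k:ℝ) * z j / N)
      + (∑ j ∈ U, 2 / (N * |Real.sin (Real.pi * ((k:ℝ) * z j / N))|)) * B ^ U.card := by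
    intro k hk
    have hE : ∀ j ∈ U, |auxG N ((k:ℝ) * z j / N) - lsin ((k:ℝ) * z j / N)| ≤ 2 / (N * |Real.sin (Real.pi * ((k:ℝ) * z j / N))|)
       ∧ 2 / (N * |Real.sin (Real.pi * ((k:ℝ) * z j / N))|) ≤ 1 ∧ |lsin ((k:ℝ) * z j / N)| ≤ 2 * Real.log N := by
      intro j hj
      have h1 := aux_sin_lb N hN (z j) (hz j hj) k hk
      have hpos : 0 < |Real.sin (Real.pi * ((k:ℝ) * z j / N))| := lt_of_lt_of_le (by positivity) h1
      refine ⟨aux_lsin _ (abs_pos.mp hpos) N hN, ?_, ?_⟩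
      · rw [div_le_one (by positivity)]
        rw [div_le_iff₀ (by positivity)] at h1; linarith
      · have hl : lsin ((k:ℝ) * z j / N) = - (2 * Real.log |Real.sin (Real.pi * ((k:ℝ) * z j / N))|) := by
          unfold lsin
          rw [← sq_abs, one_div, Real.log_inv, Real.log_pow]; push_cast; ring
        have h5 : Real.log |Real.sin (Real.pi * ((k:ℝ) * z j / N))| ≤ 0 :=
          Real.log_nonpos hpos.le (Real.abs_sin_le_one _)
        have h6 : - Real.log N ≤ Real.log |Real.sin (Real.pi * ((k:ℝ) * z j / N))| := by
          rw [← Real.log_inv]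
          apply Real.log_le_log (by positivity)
          refine le_trans ?_ h1
          rw [inv_eq_one_div]; gcongr; norm_num
        rw [hl, abs_le]; constructor <;> linarith
    have hp := aux_prod U (fun j => lsin ((k:ℝ) * z j / N)) (fun j => auxG N ((k:ℝ) * z j / N)) B hB1
      (fun j hj => by have := (hE j hj).2.2; linarith)
      (fun j hj => by
        obtain ⟨h1, h2, h3⟩ := hE j hj
        have := abs_add_le (auxG N ((k:ℝ) * z j / N) - lsin ((k:ℝ) * z j / N)) (lsin ((k:ℝ) * z j / N))
        rw [sub_add_cancel] at this
        linarith)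
    have h7 : (∑ j ∈ U, |auxG N ((k:ℝ) * z j / N) - lsin ((k:ℝ) * z j / N)|) * B ^ U.card ≤ (∑ j ∈ U, 2 / (N * |Real.sin (Real.pi * ((k:ℝ) * z j / N))|)) * B ^ U.card := by
      apply mul_le_mul_of_nonneg_right _ (by positivity)
      exact sum_le_sum fun j hj => (hE j hj).1
    have := (le_abs_self _).trans (hp.trans h7)
    linarith
  refine (sum_le_sum step).trans ?_
  rw [sum_add_distrib, ← sum_mul, sum_comm]
  have h8 : ∑ j ∈ U, ∑ k ∈ Icc 1 (N-1), 2 / (N * |Real.sin (Real.pi * ((k:ℝ) * z j / N))|) ≤ 2 ^ U.card * (2 * (1 + Real.log N)) := by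
    refine (sum_le_sum fun j hj => aux_perm_sum N hN (z j) (hz j hj)).trans ?_
    rw [sum_const, nsmul_eq_mul]
    have : (U.card : ℝ) ≤ 2 ^ U.card := by exact_mod_cast Nat.lt_two_pow_self.le
    gcongr
  have := mul_le_mul_of_nonneg_right h8 (by positivity : 0 ≤ B ^ U.card)
  rw [pow_succ]
  linarith

lemma auxG_zero (N : ℕ) (hN : 1 ≤ N) : 0 ≤ auxG N 0 ∧ auxG N 0 ≤ Real.log 4 + 2 * (1 + Real.log N) := by
  have h := aux_harm N hN
  have h4 : 0 ≤ Real.log 4 := Real.log_nonneg (by norm_num)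
  have h5 : 0 ≤ ∑ m ∈ range N, 1 / (m:ℝ) := sum_nonneg fun _ _ => by positivity
  have e : auxG N 0 = Real.log 4 + 2 * ∑ m ∈ range N, 1 / (m:ℝ) := by simp [auxG]
  rw [e]; constructor <;> linarith

def auxc (m : ℤ) : ℝ := if m = 0 then Real.log 4 else 1 / |(m:ℝ)|

def auxe (x : ℝ) : ℂ := Complex.exp ((2 * Real.pi * x : ℝ) * Complex.I)

lemma auxG_eq (N : ℕ) (hN : 1 ≤ N) (x : ℝ) :
    (auxG N x : ℂ) = ∑ m ∈ Icc (-(N:ℤ)+1) ((N:ℤ)-1), (auxc m : ℂ) * auxe (m * x) := by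
  induction N, hN using Nat.le_induction with
  | base => simp [auxG, auxc, auxe]
  | succ N hN ih =>
    have hI : Icc (-((N+1:ℕ):ℤ)+1) (((N+1:ℕ):ℤ)-1) = insert (N:ℤ) (insert (-(N:ℤ)) (Icc (-(N:ℤ)+1) ((N:ℤ)-1))) := by
      ext m; simp only [mem_Icc, mem_insert]; push_cast; omega
    have hN0 : (N:ℤ) ≠ 0 := by omega
    rw [hI, sum_insert (by simp only [mem_Icc, mem_insert]; omega), sum_insert (by simp only [mem_Icc]; omega), ← ih]
    have e1 : auxG (N+1) x = auxG N x + 2 * (Real.cos (2 * Real.pi * N * x) / N) := by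
      simp only [auxG, sum_range_succ]; ring
    rw [e1]
    have e2 : auxc (N:ℤ) = 1 / N := by simp [auxc, show N ≠ 0 by omega]
    have e3 : auxc (-(N:ℤ)) = 1 / N := by simp [auxc, show N ≠ 0 by omega]
    rw [e2, e3]
    have e4 : auxe (((N:ℤ):ℝ) * x) + auxe (((-(N:ℤ) : ℤ):ℝ) * x) = 2 * (Real.cos (2 * Real.pi * N * x) : ℂ) := by
      rw [Complex.ofReal_cos, Complex.two_cos]
      unfold auxe
      congr 2 <;> (push_cast; ring)
    have : (1 / (N:ℝ) : ℝ) * auxe (((N:ℤ):ℝ) * x) + ((1 / (N:ℝ) : ℝ) * auxe (((-(N:ℤ) : ℤ):ℝ) * x) + (auxG N x : ℂ)) = (auxG N x : ℂ) + (1 / (N:ℝ) : ℝ) * (auxe (((N:ℤ):ℝ) * x) + auxe (((-(N:ℤ) : ℤ):ℝ) * x)) := by ring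
    rw [this, e4]; push_cast; ring

lemma auxe_sum {ι : Type*} (t : Finset ι) (f : ι → ℝ) : auxe (∑ i ∈ t, f i) = ∏ i ∈ t, auxe (f i) := by
  unfold auxe
  rw [← Complex.exp_sum]; congr 1; push_cast; rw [mul_sum, sum_mul]

lemma auxe_int (a : ℤ) : auxe a = 1 := by
  unfold auxe
  rw [Complex.exp_eq_one_iff]
  exact ⟨a, by push_cast; ring⟩

lemma auxe_avg (N : ℕ) (hN : 1 ≤ N) (a : ℤ) :
    ∑ k ∈ range N, auxe ((k:ℝ) * (a / N)) = if a % (N:ℤ) = 0 then (N:ℂ) else 0 := by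
  have hN0 : (N:ℝ) ≠ 0 := by exact_mod_cast (by omega : N ≠ 0)
  have hNc : (N:ℂ) ≠ 0 := by exact_mod_cast hN0
  have hp : ∀ k : ℕ, auxe ((k:ℝ) * (a / N)) = auxe (a / N) ^ k := by
    intro k; unfold auxe; rw [← Complex.exp_nat_mul]; congr 1; push_cast; ring
  simp only [hp]
  split_ifs with h
  · obtain ⟨q, rfl⟩ := Int.dvd_of_emod_eq_zero h
    have : ((((N:ℤ) * q : ℤ) : ℝ) / N) = ((q:ℤ):ℝ) := by push_cast; field_simp
    rw [this, auxe_int]; simp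
  · have hne : auxe (a / N) ≠ 1 := by
      intro h1
      apply h
      unfold auxe at h1
      rw [Complex.exp_eq_one_iff] at h1
      obtain ⟨q, hq⟩ := h1
      have h2 : ((2 * Real.pi * (a / N) : ℝ) : ℂ) = ((q * (2 * Real.pi) : ℝ) : ℂ) := by
        apply mul_right_cancel₀ Complex.I_ne_zero
        rw [hq]; push_cast; ring
      have h3 := Complex.ofReal_injective h2
      have h4 : (a:ℝ) / N = q := by
        have := Real.pi_pos
        apply mul_left_cancel₀ (show 2 * Real.pi ≠ 0 by positivity)
        linarith
      rw [div_eq_iff hN0] at h4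
      have h5 : a = q * N := by exact_mod_cast h4
      rw [h5]; simp
    have hz : auxe (a / N) ^ N = 1 := by
      rw [← hp]
      have : (N:ℝ) * (a / N) = ((a:ℤ):ℝ) := by field_simp
      rw [this, auxe_int]
    rw [geom_sum_eq hne, hz]; simp

lemma aux_reindex {M : Type*} [CommMonoid M] (s : ℕ) (U : Finset ℕ) (hU : U ⊆ Icc 1 s) (g : ℕ → M) :
    ∏ j : Fin s, (if (j:ℕ)+1 ∈ U then g ((j:ℕ)+1) else 1) = ∏ j ∈ U, g j := by
  rw [← prod_filter]
  apply prod_nbij (fun j : Fin s => (j:ℕ)+1)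
  · intro j hj; simpa using hj
  · intro i _ j _ h; simp only at h; ext; omega
  · intro j hj
    have h1 := mem_Icc.mp (hU hj)
    refine ⟨⟨j-1, by omega⟩, ?_, ?_⟩
    · have : j - 1 + 1 = j := by omega
      simpa [this] using hj
    · simp only; omega
  · intros; rfl

lemma aux_avg (N s : ℕ) (hN : 1 ≤ N) (z : ℕ → ℤ) (U : Finset ℕ) (hU : U ⊆ Icc 1 s) :
    (1 / (N:ℝ)) * ∑ k ∈ range N, ∏ j ∈ U, auxG N ((k:ℝ) * z j / N) =
    ∑ m ∈ (Fintype.piFinset fun j : Fin s => if (j:ℕ)+1 ∈ U then Icc (-(N:ℤ)+1) ((N:ℤ)-1) else {0}).filter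
      (fun m => (∑ j : Fin s, m j * z ((j : ℕ) + 1)) % (N : ℤ) = 0),
      ∏ j : Fin s, (if (j:ℕ)+1 ∈ U then auxc (m j) else 1) := by
  have hN0 : (N:ℝ) ≠ 0 := by exact_mod_cast (by omega : N ≠ 0)
  have hNc : (N:ℂ) ≠ 0 := by exact_mod_cast hN0
  apply Complex.ofReal_injective
  rw [sum_filter]
  push_cast
  set P := (Fintype.piFinset fun j : Fin s => if (j:ℕ)+1 ∈ U then Icc (-(N:ℤ)+1) ((N:ℤ)-1) else {0}) with hP
  have h1 : ∀ k ∈ range N, ∏ j ∈ U, (auxG N ((k:ℝ) * z j / N) : ℂ) =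
      ∑ m ∈ P, (∏ j : Fin s, (if (j:ℕ)+1 ∈ U then (auxc (m j):ℂ) else 1)) * auxe ((k:ℝ) * ((∑ j : Fin s, m j * z ((j : ℕ) + 1) : ℤ) / N)) := by
    intro k _
    rw [← aux_reindex s U hU (fun j => (auxG N ((k:ℝ) * z j / N) : ℂ))]
    have h2 : ∀ j : Fin s, (if (j:ℕ)+1 ∈ U then (auxG N ((k:ℝ) * z ((j:ℕ)+1) / N) : ℂ) else 1) =
       ∑ m ∈ (if (j:ℕ)+1 ∈ U then Icc (-(N:ℤ)+1) ((N:ℤ)-1) else {0}), (if (j:ℕ)+1 ∈ U then (auxc m:ℂ) else 1) * auxe (m * ((k:ℝ) * z ((j:ℕ)+1) / N)) := by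
      intro j
      split_ifs with h
      · exact auxG_eq N hN _
      · simp [auxe]
    simp only [h2]
    rw [prod_univ_sum]
    apply sum_congr rfl
    intro m _
    rw [prod_mul_distrib, ← auxe_sum]
    congr 2
    push_cast
    rw [sum_div, mul_sum]
    apply sum_congr rfl
    intros; ring
  rw [sum_congr rfl h1, sum_comm, mul_sum]
  apply sum_congr rfl
  intro m _
  rw [← mul_sum, auxe_avg N hN]
  split_ifs with h
  · rw [one_div, mul_comm, mul_assoc, mul_inv_cancel₀ hNc, mul_one]
    push_cast
    apply prod_congr rfl; intros; split_ifs <;> simp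
  · simp

lemma mem_msupp {s : ℕ} (m : Fin s → ℤ) (j : Fin s) : (j:ℕ)+1 ∈ msupp m ↔ m j ≠ 0 := by
  unfold msupp
  simp only [mem_image, mem_filter, mem_univ, true_and]
  constructor
  · rintro ⟨i, hi, h⟩
    have : i = j := by ext; omega
    rwa [← this]
  · intro h; exact ⟨j, h, rfl⟩

lemma aux_TU (N s : ℕ) (hN : 1 ≤ N) (z : ℕ → ℤ) (U : Finset ℕ) (hU : U ⊆ Icc 1 s) (hU0 : U ≠ ∅) :
    ∑ m ∈ ((Fintype.piFinset fun _ : Fin s => Finset.Icc (-(N : ℤ) + 1) ((N : ℤ) - 1)).filter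
      (fun m => m ≠ 0 ∧ (∑ j : Fin s, m j * z ((j : ℕ) + 1)) % (N : ℤ) = 0)).filter (fun m => msupp m = U),
      ∏ j ∈ univ.filter (fun j => m j ≠ 0), 1 / |(m j : ℝ)| + Real.log 4 ^ U.card
    ≤ (1 / (N:ℝ)) * ∑ k ∈ range N, ∏ j ∈ U, auxG N ((k:ℝ) * z j / N) := by
  rw [aux_avg N s hN z U hU]
  set S := ((Fintype.piFinset fun _ : Fin s => Finset.Icc (-(N : ℤ) + 1) ((N : ℤ) - 1)).filter
      (fun m => m ≠ 0 ∧ (∑ j : Fin s, m j * z ((j : ℕ) + 1)) % (N : ℤ) = 0)).filter (fun m => msupp m = U) with hS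
  have h4 : 0 ≤ Real.log 4 := Real.log_nonneg (by norm_num)
  have h0S : (0 : Fin s → ℤ) ∉ S := by simp [hS]
  have e0 : ∏ j : Fin s, (if (j:ℕ)+1 ∈ U then auxc ((0 : Fin s → ℤ) j) else 1) = Real.log 4 ^ U.card := by
    have := aux_reindex s U hU (fun _ => Real.log 4)
    rw [prod_const] at this
    rw [← this]
    simp [auxc]
  have e1 : ∀ m ∈ S, ∏ j ∈ univ.filter (fun j => m j ≠ 0), 1 / |(m j : ℝ)| = ∏ j : Fin s, (if (j:ℕ)+1 ∈ U then auxc (m j) else 1) := by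
    intro m hm
    have hm2 := (mem_filter.mp hm).2
    rw [prod_filter]
    apply prod_congr rfl
    intro j _
    rw [← hm2]
    simp only [mem_msupp]
    by_cases h : m j = 0 <;> simp [h, auxc]
  rw [sum_congr rfl e1, ← e0, add_comm, ← sum_insert (f := fun m : Fin s → ℤ => ∏ j : Fin s, (if (j:ℕ)+1 ∈ U then auxc (m j) else 1)) h0S]
  apply sum_le_sum_of_subset_of_nonneg
  · intro m hm
    rw [mem_filter, Fintype.mem_piFinset]
    rcases mem_insert.mp hm with rfl | hm
    · refine ⟨fun j => ?_, by simp⟩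
      split_ifs
      · simp only [Pi.zero_apply, mem_Icc]; omega
      · simp
    · obtain ⟨hm1, hm2⟩ := mem_filter.mp hm
      obtain ⟨hm3, hm4, hm5⟩ := mem_filter.mp hm1
      refine ⟨fun j => ?_, hm5⟩
      split_ifs with h
      · exact Fintype.mem_piFinset.mp hm3 j
      · rw [← hm2, mem_msupp, not_not] at h
        simp [h]
  · intro m _ _
    apply prod_nonneg
    intro j _
    unfold auxc
    split_ifs <;> positivity

/-- for `N = 2^n`, `n ≥ 1`, strictly positive weights `γ` and
`z ∈ {1,…,N-1}^s` with `gcd(z_j,N) = 1` satisfying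
`H_{s,n,γ}(z) ≤ N ∑_{∅≠v⊆{1:s}} (log 4)^{|v|} γ_v`, one has
`T_{1,γ}(N,z) ≤ ∑_{∅≠u} (γ_u/N)(log 4 + 2(1+log N))^{|u|}
  + ∑_{∅≠u} (γ_u/N) 2^{|u|+1} (1+2 log N)^{|u|} (1+log N)`. -/
theorem statement8 (n : ℕ) (hn : 1 ≤ n) (s : ℕ) (hs : 1 ≤ s)
    (γ : Finset ℕ → ℝ) (hγpos : ∀ u, 0 < γ u) (hγempty : γ ∅ = 1)
    (z : ℕ → ℤ)
    (hzrange : ∀ j ∈ Finset.Icc 1 s, 1 ≤ z j ∧ z j ≤ 2 ^ n - 1)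
    (hgcd : ∀ j ∈ Finset.Icc 1 s, Int.gcd (z j) ((2 : ℤ) ^ n) = 1)
    (hH : Hsum γ s n z ≤
      2 ^ n * ∑ v ∈ (Finset.Icc 1 s).powerset.filter (· ≠ ∅),
        Real.log 4 ^ v.card * γ v) :
    Tsum 1 γ (2 ^ n) s z ≤
      (∑ u ∈ (Finset.Icc 1 s).powerset.filter (· ≠ ∅),
          γ u / 2 ^ n * (Real.log 4 + 2 * (1 + Real.log (2 ^ n))) ^ u.card)
      + ∑ u ∈ (Finset.Icc 1 s).powerset.filter (· ≠ ∅),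
          γ u / 2 ^ n * 2 ^ (u.card + 1) * (1 + 2 * Real.log (2 ^ n)) ^ u.card
            * (1 + Real.log (2 ^ n)) := by
  set P := (Finset.Icc 1 s).powerset.filter (· ≠ ∅) with hP
  set N : ℕ := 2 ^ n with hNdef
  have hN : 1 ≤ N := Nat.one_le_two_pow
  have hNr : ((2:ℝ) ^ n) = (N:ℝ) := by rw [hNdef]; push_cast; ring
  have hNz : ((2:ℤ) ^ n) = (N:ℤ) := by rw [hNdef]; push_cast; ring
  have hN0 : (0:ℝ) < N := by exact_mod_cast hN
  have hPsub : ∀ U ∈ P, U ⊆ Icc 1 s ∧ U ≠ ∅ := by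
    intro U hU
    rw [hP, mem_filter, mem_powerset] at hU
    exact hU
  have hcop : ∀ U ∈ P, ∀ j ∈ U, IsCoprime (z j) (N:ℤ) := by
    intro U hU j hj
    rw [← hNz, Int.isCoprime_iff_gcd_eq_one]
    exact hgcd j ((hPsub U hU).1 hj)
  unfold Hsum at hH
  rw [← hP] at hH
  rw [hNr] at hH ⊢
  rw [sum_comm] at hH
  simp only [← mul_sum] at hH
  unfold Tsum
  have hmaps : ∀ m ∈ ((Fintype.piFinset fun _ : Fin s => Finset.Icc (-(N : ℤ) + 1) ((N : ℤ) - 1)).filter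
      (fun m => m ≠ 0 ∧ (∑ j : Fin s, m j * z ((j : ℕ) + 1)) % (N : ℤ) = 0)), msupp m ∈ P := by
    intro m hm
    have hm0 := (mem_filter.mp hm).2.1
    rw [hP, mem_filter, mem_powerset]
    constructor
    · intro i hi
      unfold msupp at hi
      obtain ⟨j, _, rfl⟩ := mem_image.mp hi
      rw [mem_Icc]; omega
    · intro h
      apply hm0
      funext j
      by_contra hj
      have := (mem_msupp m j).mpr hj
      rw [h] at this
      simp at this
  rw [← sum_fiberwise_of_maps_to hmaps]
  have key : ∀ U ∈ P, ∑ m ∈ ((Fintype.piFinset fun _ : Fin s => Finset.Icc (-(N : ℤ) + 1) ((N : ℤ) - 1)).filter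
      (fun m => m ≠ 0 ∧ (∑ j : Fin s, m j * z ((j : ℕ) + 1)) % (N : ℤ) = 0)).filter (fun m => msupp m = U), 1 / rweight 1 γ m
      ≤ γ U / N * (Real.log 4 + 2 * (1 + Real.log N)) ^ U.card
        + (1 / (N:ℝ)) * (γ U * ∑ k ∈ Icc 1 (N-1), ∏ j ∈ U, lsin ((k:ℝ) * z j / N))
        + γ U / N * 2 ^ (U.card + 1) * (1 + 2 * Real.log N) ^ U.card * (1 + Real.log N)
        - Real.log 4 ^ U.card * γ U := by
    intro U hU
    have h1 := aux_TU N s hN z U (hPsub U hU).1 (hPsub U hU).2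
    have h2 := aux_error N hN z U (hcop U hU)
    have h3 : ∑ k ∈ range N, ∏ j ∈ U, auxG N ((k:ℝ) * z j / N) = ∏ j ∈ U, auxG N 0 + ∑ k ∈ Icc 1 (N-1), ∏ j ∈ U, auxG N ((k:ℝ) * z j / N) := by
      have : range N = insert 0 (Icc 1 (N-1)) := by
        ext k; simp only [mem_range, mem_insert, mem_Icc]; omega
      rw [this, sum_insert (by simp)]
      simp
    obtain ⟨g1, g2⟩ := auxG_zero N hN
    have h4 : ∏ j ∈ U, auxG N 0 ≤ (Real.log 4 + 2 * (1 + Real.log N)) ^ U.card := by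
      rw [prod_const]
      exact pow_le_pow_left₀ g1 g2 _
    have h5 : ∀ m ∈ ((Fintype.piFinset fun _ : Fin s => Finset.Icc (-(N : ℤ) + 1) ((N : ℤ) - 1)).filter
      (fun m => m ≠ 0 ∧ (∑ j : Fin s, m j * z ((j : ℕ) + 1)) % (N : ℤ) = 0)).filter (fun m => msupp m = U), 1 / rweight 1 γ m
       = γ U * ∏ j ∈ univ.filter (fun j => m j ≠ 0), 1 / |(m j : ℝ)| := by
      intro m hm
      have hm2 := (mem_filter.mp hm).2
      unfold rweight
      rw [hm2]
      simp only [Real.rpow_one, one_div, mul_inv, inv_inv, prod_inv_distrib]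
    rw [sum_congr rfl h5, ← mul_sum]
    rw [h3] at h1
    have h6 := h1.trans (mul_le_mul_of_nonneg_left (add_le_add h4 h2) (by positivity : 0 ≤ 1 / (N:ℝ)))
    have h7 := mul_le_mul_of_nonneg_left h6 (hγpos U).le
    have e : γ U * (1 / (N:ℝ) * ((Real.log 4 + 2 * (1 + Real.log N)) ^ U.card + (∑ k ∈ Icc 1 (N-1), ∏ j ∈ U, lsin ((k:ℝ) * z j / N) +
      2 ^ (U.card + 1) * (1 + 2 * Real.log N) ^ U.card * (1 + Real.log N)))) = γ U / N * (Real.log 4 + 2 * (1 + Real.log N)) ^ U.card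
        + (1 / (N:ℝ)) * (γ U * ∑ k ∈ Icc 1 (N-1), ∏ j ∈ U, lsin ((k:ℝ) * z j / N))
        + γ U / N * 2 ^ (U.card + 1) * (1 + 2 * Real.log N) ^ U.card * (1 + Real.log N) := by ring
    rw [e] at h7
    linarith
  refine (sum_le_sum key).trans ?_
  rw [sum_sub_distrib, sum_add_distrib, sum_add_distrib, ← mul_sum]
  have h9 := mul_le_mul_of_nonneg_left hH (by positivity : 0 ≤ 1 / (N:ℝ))
  rw [← mul_assoc, one_div_mul_cancel hN0.ne', one_mul] at h9
  linarith

end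
end

section
/- Let γ = {γ_u} be strictly positive weights such that Σ_{j≥1} γ̃_j < ∞, where γ̃_j := max_{v⊆{1,…,j−1}} γ_{v∪{j}}/γ_v. Then for every a > 0 and every δ > 0 there exists a constant C_δ > 0, independent of s and N, such that for all s ∈ ℕ and all integers N ≥ 2, (1 + log N) · Σ_{∅≠u⊆{1,…,s}} (γ_u/N)(a log N)^{|u|} ≤ C_δ / N^{1−δ}. -/
open Finset MeasureTheory

noncomputable section

lemma tildeW_nonneg (γ : Finset ℕ → ℝ) (hγpos : ∀ u, 0 < γ u) (j : ℕ) : 0 ≤ tildeW γ j := by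
  unfold tildeW
  refine le_trans (div_pos (hγpos (insert j ∅)) (hγpos ∅)).le ?_
  exact Finset.le_sup' (fun v => γ (insert j v) / γ v) (Finset.empty_mem_powerset _)

lemma le_tildeW (γ : Finset ℕ → ℝ) (hγpos : ∀ u, 0 < γ u) (j : ℕ) (v : Finset ℕ)
    (hv : v ∈ (Finset.Icc 1 j).powerset) : γ (insert (j + 1) v) ≤ tildeW γ (j + 1) * γ v := by
  rw [← div_le_iff₀ (hγpos v)]
  unfold tildeW
  exact Finset.le_sup' (fun v => γ (insert (j + 1) v) / γ v) (by simpa using hv)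

lemma sum_le_prod_tildeW (γ : Finset ℕ → ℝ) (hγpos : ∀ u, 0 < γ u) (hγempty : γ ∅ = 1)
    (x : ℝ) (hx : 0 ≤ x) (s : ℕ) :
    ∑ u ∈ (Finset.Icc 1 s).powerset, γ u * x ^ u.card ≤
      ∏ j ∈ Finset.range s, (1 + x * tildeW γ (j + 1)) := by
  induction s with
  | zero => simp [hγempty]
  | succ s ih =>
    have hI : Finset.Icc 1 (s + 1) = insert (s + 1) (Finset.Icc 1 s) := by
      ext i; simp only [Finset.mem_Icc, Finset.mem_insert]; omega
    have hn : s + 1 ∉ Finset.Icc 1 s := by simp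
    rw [hI, Finset.sum_powerset_insert hn, Finset.prod_range_succ]
    have h2 : ∑ u ∈ (Finset.Icc 1 s).powerset, γ (insert (s + 1) u) * x ^ (insert (s + 1) u).card
        ≤ (x * tildeW γ (s + 1)) * ∑ u ∈ (Finset.Icc 1 s).powerset, γ u * x ^ u.card := by
      rw [Finset.mul_sum]
      refine Finset.sum_le_sum fun u hu => ?_
      have hnu : s + 1 ∉ u := fun h => hn (Finset.mem_powerset.1 hu h)
      rw [Finset.card_insert_of_notMem hnu, pow_succ]
      have := mul_le_mul_of_nonneg_right (le_tildeW γ hγpos s u hu)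
        (mul_nonneg (pow_nonneg hx u.card) hx)
      linarith
    have h0 : 0 ≤ 1 + x * tildeW γ (s + 1) := by
      have := mul_nonneg hx (tildeW_nonneg γ hγpos (s + 1)); linarith
    have h3 := mul_le_mul_of_nonneg_right ih h0
    linarith

lemma one_add_le_exp (c ε L : ℝ) (hc : 0 ≤ c) (hε : 0 < ε) (hL : 0 ≤ L) :
    1 + c * L ≤ (1 + c / ε) * Real.exp (ε * L) := by
  have h1 : 1 ≤ Real.exp (ε * L) := Real.one_le_exp (by positivity)
  have h2 : ε * L ≤ Real.exp (ε * L) := by linarith [Real.add_one_le_exp (ε * L)]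
  have h3 : c * L = c / ε * (ε * L) := by field_simp
  have h4 := mul_le_mul_of_nonneg_left h2 (div_nonneg hc hε.le)
  linarith

/-- cf. Lemma 4: if the weights satisfy `∑_{j≥1} γ̃_j < ∞` with
`γ̃_j = max_{v⊆{1:j-1}} γ_{v∪{j}}/γ_v`, then for all `a > 0` and `δ > 0` there is a
constant `C_δ > 0`, independent of `s` and `N`, with
`(1 + log N) ∑_{∅≠u⊆{1:s}} (γ_u/N)(a log N)^{|u|} ≤ C_δ / N^{1-δ}`. -/
theorem statement9 (γ : Finset ℕ → ℝ) (hγpos : ∀ u, 0 < γ u) (hγempty : γ ∅ = 1)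
    (hsum : Summable fun j : ℕ => tildeW γ (j + 1)) :
    ∀ a > (0 : ℝ), ∀ δ > (0 : ℝ), ∃ C > (0 : ℝ),
      ∀ s : ℕ, 1 ≤ s → ∀ N : ℕ, 2 ≤ N →
        (1 + Real.log N) *
            ∑ u ∈ (Finset.Icc 1 s).powerset.filter (· ≠ ∅),
              γ u / N * (a * Real.log N) ^ u.card
          ≤ C / (N : ℝ) ^ (1 - δ) := by
  intro a ha δ hδ
  set t : ℕ → ℝ := fun j => tildeW γ (j + 1) with ht
  have ht0 : ∀ j, 0 ≤ t j := fun j => tildeW_nonneg γ hγpos _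
  obtain ⟨d, hd⟩ : ∃ d, ∑' k, t (k + d) < δ / (2 * a) :=
    ((tendsto_sum_nat_add t).eventually (gt_mem_nhds (by positivity))).exists
  set ε : ℝ := δ / (2 * (d + 1)) with hε
  have hε0 : 0 < ε := by positivity
  have hP0 : 0 < ∏ j ∈ Finset.range d, (1 + a * t j / ε) := Finset.prod_pos fun j _ => by
    have := ht0 j; positivity
  refine ⟨(1 + 1 / ε) * ∏ j ∈ Finset.range d, (1 + a * t j / ε), by positivity, ?_⟩
  intro s _ N hN
  have hNr : (0 : ℝ) < N := by positivity
  set L := Real.log N with hLdef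
  have hL : 0 ≤ L := Real.log_natCast_nonneg N
  have hx : 0 ≤ a * L := by positivity
  have hpos1 : ∀ j, 0 ≤ 1 + a * L * t j := fun j => by have := ht0 j; positivity
  have hA : ∑ u ∈ (Finset.Icc 1 s).powerset.filter (· ≠ ∅), γ u / N * (a * L) ^ u.card
      ≤ (∏ j ∈ Finset.range s, (1 + a * L * t j)) / N := by
    calc _ ≤ ∑ u ∈ (Finset.Icc 1 s).powerset, γ u / N * (a * L) ^ u.card :=
          Finset.sum_le_sum_of_subset_of_nonneg (Finset.filter_subset _ _)
            (fun u _ _ => by have := hγpos u; positivity)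
      _ = (∑ u ∈ (Finset.Icc 1 s).powerset, γ u * (a * L) ^ u.card) / N := by
          rw [Finset.sum_div]; exact Finset.sum_congr rfl fun u _ => by ring
      _ ≤ _ := by
          gcongr
          exact sum_le_prod_tildeW γ hγpos hγempty _ hx s
  have hB : ∏ j ∈ Finset.range s, (1 + a * L * t j) ≤
      ∏ j ∈ Finset.range (d + s), (1 + a * L * t j) := by
    rw [add_comm d s, Finset.prod_range_add]
    refine le_mul_of_one_le_right (Finset.prod_nonneg fun j _ => hpos1 j) ?_
    calc (1 : ℝ) = ∏ j ∈ Finset.range d, (1 : ℝ) := by simp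
      _ ≤ _ := Finset.prod_le_prod (fun _ _ => zero_le_one) fun j _ => by
          have := mul_nonneg hx (ht0 (s + j)); linarith
  rw [Finset.prod_range_add] at hB
  have hC : ∏ j ∈ Finset.range d, (1 + a * L * t j) ≤
      (∏ j ∈ Finset.range d, (1 + a * t j / ε)) * Real.exp (d * (ε * L)) := by
    calc _ ≤ ∏ j ∈ Finset.range d, ((1 + a * t j / ε) * Real.exp (ε * L)) := by
          refine Finset.prod_le_prod (fun j _ => hpos1 j) fun j _ => ?_
          have := one_add_le_exp (a * t j) ε L (mul_nonneg ha.le (ht0 j)) hε0 hL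
          linarith
      _ = _ := by
          rw [Finset.prod_mul_distrib, Finset.prod_const, Finset.card_range, Real.exp_nat_mul]
  have hD : ∏ j ∈ Finset.range s, (1 + a * L * t (d + j)) ≤ Real.exp (δ / 2 * L) := by
    calc _ ≤ ∏ j ∈ Finset.range s, Real.exp (a * L * t (d + j)) := by
          refine Finset.prod_le_prod (fun j _ => hpos1 _) fun j _ => ?_
          linarith [Real.add_one_le_exp (a * L * t (d + j))]
      _ = Real.exp (a * L * ∑ j ∈ Finset.range s, t (j + d)) := by
          rw [← Real.exp_sum, Finset.mul_sum]; simp only [add_comm]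
      _ ≤ _ := by
          apply Real.exp_le_exp.2
          have h1 : ∑ j ∈ Finset.range s, t (j + d) ≤ δ / (2 * a) :=
            (((summable_nat_add_iff d).2 hsum).sum_le_tsum _ (fun j _ => ht0 _)).trans hd.le
          calc _ ≤ a * L * (δ / (2 * a)) := mul_le_mul_of_nonneg_left h1 hx
            _ = _ := by field_simp
  have hE := one_add_le_exp 1 ε L zero_le_one hε0 hL
  rw [one_mul] at hE
  have hrhs : (N : ℝ) ^ (1 - δ) = N / Real.exp (δ * L) := by
    rw [Real.rpow_sub hNr, Real.rpow_one, Real.rpow_def_of_pos hNr, mul_comm]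
  have hexp : Real.exp (ε * L) * (Real.exp (d * (ε * L)) * Real.exp (δ / 2 * L))
      = Real.exp (δ * L) := by
    rw [← Real.exp_add, ← Real.exp_add]
    congr 1
    rw [hε]; field_simp; ring
  rw [hrhs]
  calc _ ≤ ((1 + 1 / ε) * Real.exp (ε * L)) *
        ((((∏ j ∈ Finset.range d, (1 + a * t j / ε)) * Real.exp (d * (ε * L))) *
          Real.exp (δ / 2 * L)) / N) := by
        refine mul_le_mul hE (hA.trans ?_) ?_ (by positivity)
        · refine div_le_div_of_nonneg_right (hB.trans ?_) hNr.le
          exact mul_le_mul hC hD (Finset.prod_nonneg fun j _ => hpos1 _) (by positivity)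
        · exact Finset.sum_nonneg fun u _ => by have := hγpos u; positivity
    _ = _ := by
        rw [← hexp]; field_simp

end
end
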